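/- arXiv:1403.2587 — 2 statements merged into one kernel-verified Lean document; each statement's English description precedes it below -/
import Mathlib

section
/- Let G be a chordless graph on n vertices. Then for every assignment L of 2-element colour lists to the vertices of G, there exists an induced subgraph of G on at least 2n/3 vertices that is L-list colourable. -/
/-- `G` is chordless: no cycle of `G` has a chord. -/
def Chordless {V : Type*} (G : SimpleGraph V) : Prop :=
  ∀ (u : V) (w : G.Walk u u), w.IsCycle →
    ∀ a ∈ w.support, ∀ b ∈ w.support, G.Adj a b → w.toSubgraph.Adj a b

open SimpleGraph

namespace PLC

variable {V : Type*} {G : SimpleGraph V}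

/-- `c` is a proper list colouring of the subgraph induced by `S`. -/
def Good (G : SimpleGraph V) (L : V → Finset ℕ) (S : Finset V) (c : V → ℕ) : Prop :=
  (∀ v ∈ S, c v ∈ L v) ∧ ∀ u ∈ S, ∀ v ∈ S, G.Adj u v → c u ≠ c v

/-- `p` is a longest path inside `U`. -/
def MaxPath (U : Finset V) {a b : V} (p : G.Walk a b) : Prop :=
  p.IsPath ∧ (∀ v ∈ p.support, v ∈ U) ∧
    ∀ (a' b' : V) (q : G.Walk a' b'), q.IsPath → (∀ v ∈ q.support, v ∈ U) → q.length ≤ p.length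

lemma decomp {a b : V} (p : G.Walk a b) : ∀ y ∈ p.support, y ≠ a →
    ∃ (w : V) (t : G.Walk a w) (e : G.Adj w y) (r : G.Walk y b),
      p = t.append (Walk.cons e r) := by
  induction p with
  | nil => intro y hy hne; simp at hy; exact absurd hy hne
  | @cons u v x h q ih =>
    intro y hy hne
    by_cases hv : y = v
    · subst hv
      exact ⟨u, Walk.nil, h, q, rfl⟩
    · have hy' : y ∈ q.support := by
        simp at hy; tauto
      obtain ⟨w, t, e, r, rfl⟩ := ih y hy' hv
      exact ⟨w, Walk.cons h t, e, r, rfl⟩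

lemma snd_of_edge {a b z : V} (p : G.Walk a b) (hp : p.IsPath) (hz : s(a, z) ∈ p.edges) :
    z = p.snd := by
  cases p with
  | nil => simp at hz
  | cons h q =>
    rw [Walk.cons_isPath_iff] at hp
    simp only [Walk.edges_cons, List.mem_cons] at hz
    rcases hz with hz | hz
    · simp only [Walk.snd_cons]
      have := Sym2.congr_right.mp hz
      exact this
    · exact absurd (q.fst_mem_support_of_mem_edges hz) hp.2

lemma chord (hG : Chordless G) {a b w y z : V} (t : G.Walk a w) (e : G.Adj w y) (r : G.Walk y b)
    (hp : (t.append (Walk.cons e r)).IsPath) (hay : G.Adj a y) (haz : G.Adj a z)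
    (hz : z ∈ t.support) (hyz : y ≠ z) (hys : y ≠ (t.append (Walk.cons e r)).snd) :
    z = (t.append (Walk.cons e r)).snd := by
  have heq : t.append (Walk.cons e r) = (t.concat e).append r := by
    rw [Walk.concat_append]
  have hsub : ∀ x, x ∈ (t.concat e).edges → x ∈ (t.append (Walk.cons e r)).edges := by
    intro x hx
    rw [heq, Walk.edges_append]
    exact List.mem_append_left _ hx
  have hpt : (t.concat e).IsPath := by
    rw [heq] at hp; exact hp.of_append_left
  have hcyc : (Walk.cons hay.symm (t.concat e)).IsCycle := by
    rw [Walk.cons_isCycle_iff]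
    refine ⟨hpt, fun h => hys ?_⟩
    rw [Sym2.eq_swap] at h
    exact snd_of_edge _ hp (hsub _ h)
  have h := hG _ _ hcyc a (by simp) z (by simp [Walk.support_concat, hz]) haz
  have h2 : s(a, z) ∈ (Walk.cons hay.symm (t.concat e)).edges := by
    rw [← Walk.mem_edges_toSubgraph]; exact h
  rw [Walk.edges_cons, List.mem_cons] at h2
  rcases h2 with h2 | h2
  · rw [Sym2.eq_swap (a := y)] at h2
    exact absurd (Sym2.congr_right.mp h2).symm hyz
  · exact snd_of_edge _ hp (hsub _ h2)

lemma two_nbrs (hG : Chordless G) {a b y z : V} (p : G.Walk a b) (hp : p.IsPath)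
    (hy : y ∈ p.support) (hz : z ∈ p.support) (hay : G.Adj a y) (haz : G.Adj a z) (hyz : y ≠ z) :
    y = p.snd ∨ z = p.snd := by
  by_contra hcon
  push Not at hcon
  obtain ⟨hys, hzs⟩ := hcon
  obtain ⟨w, t, e, r, rfl⟩ := decomp p y hy hay.ne'
  rw [Walk.mem_support_append_iff, Walk.support_cons, List.mem_cons] at hz
  have key : z ∈ t.support ∨ z ∈ r.support := by
    rcases hz with hz | rfl | hz
    · exact Or.inl hz
    · exact Or.inl t.end_mem_support
    · exact Or.inr hz
  rcases key with hz | hz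
  · exact hzs (chord hG t e r hp hay haz hz hyz hys)
  · obtain ⟨w', r1, e', r2, rfl⟩ := decomp r z hz hyz.symm
    have heq : t.append (Walk.cons e (r1.append (Walk.cons e' r2)))
        = (t.append (Walk.cons e r1)).append (Walk.cons e' r2) := by
      rw [← Walk.append_assoc]; rfl
    rw [heq] at hp hys hzs
    exact hys (chord hG (t.append (Walk.cons e r1)) e' r2 hp haz hay
      (by simp [Walk.mem_support_append_iff]) hyz.symm hzs)

lemma MaxPath.nbr_mem {U : Finset V} {a b y : V} {p : G.Walk a b} (hp : MaxPath U p)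
    (hy : y ∈ U) (hay : G.Adj a y) : y ∈ p.support := by
  by_contra hcon
  have := hp.2.2 _ _ (Walk.cons hay.symm p) (by rw [Walk.cons_isPath_iff]; exact ⟨hp.1, hcon⟩)
    (by
      intro v hv
      rw [Walk.support_cons, List.mem_cons] at hv
      rcases hv with rfl | hv
      · exact hy
      · exact hp.2.1 v hv)
  simp at this

lemma MaxPath.uniq (hG : Chordless G) {U : Finset V} {a b y z z' : V} {p : G.Walk a b}
    (hp : MaxPath U p) (hy : y ∈ U) (hz : z ∈ U) (hz' : z' ∈ U)
    (hay : G.Adj a y) (haz : G.Adj a z) (haz' : G.Adj a z') (h : z ≠ y) (h' : z' ≠ y) :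
    z = z' := by
  by_contra hne
  have h1 := two_nbrs hG p hp.1 (hp.nbr_mem hy hay) (hp.nbr_mem hz haz) hay haz h.symm
  have h2 := two_nbrs hG p hp.1 (hp.nbr_mem hy hay) (hp.nbr_mem hz' haz') hay haz' h'.symm
  have h3 := two_nbrs hG p hp.1 (hp.nbr_mem hz haz) (hp.nbr_mem hz' haz') haz haz' hne
  grind

lemma MaxPath.rotate {U : Finset V} {a b w y : V} (t : G.Walk a w) (e : G.Adj w y)
    (r : G.Walk y b) (hay : G.Adj a y) (hp : MaxPath U (t.append (Walk.cons e r))) :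
    MaxPath U (t.reverse.append (Walk.cons hay r)) := by
  have hperm : (t.reverse.append (Walk.cons hay r)).support.Perm
      (t.append (Walk.cons e r)).support := by
    rw [Walk.support_append, Walk.support_append, Walk.support_reverse, Walk.support_cons,
      Walk.support_cons]
    exact (List.reverse_perm _).append_right _
  obtain ⟨h1, h2, h3⟩ := hp
  refine ⟨?_, fun v hv => h2 v (hperm.mem_iff.mp hv), fun a' b' q hq hqU => ?_⟩
  · rw [Walk.isPath_def] at h1 ⊢
    exact hperm.nodup_iff.mpr h1
  · have := h3 a' b' q hq hqU
    simpa using this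

lemma exists_maxPath [Fintype V] {U : Finset V} (hU : U.Nonempty) :
    ∃ (a b : V) (p : G.Walk a b), MaxPath U p := by
  classical
  obtain ⟨u, hu⟩ := hU
  let P : ℕ → Prop := fun n => ∃ (a b : V) (p : G.Walk a b), p.IsPath ∧
    (∀ v ∈ p.support, v ∈ U) ∧ p.length = n
  have hb : ∀ n, P n → n ≤ Fintype.card V := by
    rintro n ⟨a, b, p, hp, -, rfl⟩
    exact hp.length_lt.le
  have h0 : P 0 := ⟨u, u, Walk.nil, by simp, by simpa using hu, rfl⟩
  obtain ⟨a, b, p, hp, hpU, hl⟩ := Nat.findGreatest_spec (P := P) (Nat.zero_le (Fintype.card V)) h0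
  refine ⟨a, b, p, hp, hpU, fun a' b' q hq hqU => ?_⟩
  rw [hl]
  have hPq : P q.length := ⟨a', b', q, hq, hqU, rfl⟩
  exact Nat.le_findGreatest (hb _ hPq) hPq

lemma extend [DecidableEq V] {L : V → Finset ℕ} (hL : ∀ v, (L v).card = 2) {S : Finset V}
    {c : V → ℕ} (hc : Good G L S c) {x : V} (hx : x ∉ S)
    (hu : ∀ z ∈ S, ∀ z' ∈ S, G.Adj x z → G.Adj x z' → z = z') :
    ∃ c', Good G L (insert x S) c' := by
  have hk : ∃ k ∈ L x, ∀ z ∈ S, G.Adj x z → c z ≠ k := by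
    by_cases hz : ∃ z ∈ S, G.Adj x z
    · obtain ⟨z, hz, hxz⟩ := hz
      obtain ⟨k, hk, hne⟩ := Finset.exists_mem_ne (s := L x) (by rw [hL]; norm_num) (c z)
      refine ⟨k, hk, fun z' hz' hxz' => ?_⟩
      rw [hu z' hz' z hz hxz' hxz]
      exact hne.symm
    · obtain ⟨k, hk⟩ := Finset.card_pos.mp (show 0 < (L x).card by rw [hL]; norm_num)
      exact ⟨k, hk, fun z hz' hxz => absurd ⟨z, hz', hxz⟩ hz⟩
  obtain ⟨k, hk, hkz⟩ := hk
  refine ⟨Function.update c x k, ?_, ?_⟩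
  · intro v hv
    rcases Finset.mem_insert.mp hv with rfl | hv
    · simpa using hk
    · have : v ≠ x := fun h => hx (h ▸ hv)
      simpa [this] using hc.1 v hv
  · intro u hu' v hv huv
    rcases Finset.mem_insert.mp hu' with rfl | huS
    · rcases Finset.mem_insert.mp hv with rfl | hv
      · exact absurd huv (G.loopless.irrefl _)
      · have : v ≠ u := huv.ne'
        simpa [this] using (hkz v hv huv).symm
    · have hux : u ≠ x := fun h => hx (h ▸ huS)
      rcases Finset.mem_insert.mp hv with rfl | hv
      · simpa [hux] using hkz u huS huv.symm
      · have hvx : v ≠ x := fun h => hx (h ▸ hv)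
        simpa [hux, hvx] using hc.2 u huS v hv huv

lemma main [Fintype V] (hG : Chordless G) {L : V → Finset ℕ} (hL : ∀ v, (L v).card = 2)
    (U : Finset V) : ∃ S ⊆ U, 2 * U.card ≤ 3 * S.card ∧ ∃ c, Good G L S c := by
  classical
  induction U using Finset.strongInduction with
  | H U ih =>
    rcases U.eq_empty_or_nonempty with rfl | hU
    · exact ⟨∅, by simp, by simp, fun _ => 0, by simp [Good]⟩
    obtain ⟨a, b, p, hp⟩ := exists_maxPath (G := G) hU
    have haU : a ∈ U := hp.2.1 a p.start_mem_support
    by_cases hy : ∃ y ∈ U, G.Adj a y ∧ y ≠ p.snd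
    · obtain ⟨y, hyU, hay, hys⟩ := hy
      obtain ⟨w, t, e, r, rfl⟩ := decomp p y (hp.nbr_mem hyU hay) hay.ne'
      have hrot := hp.rotate t e r hay
      have hwU : w ∈ U := hrot.2.1 w (Walk.start_mem_support _)
      have hwa : w ≠ a := by
        rintro rfl
        have ht : t = Walk.nil := by
          have h1 := hp.1.of_append_left
          exact Walk.nil_iff_eq_nil.mp (Walk.isPath_iff_nil.mp h1)
        subst ht
        simp at hys
      have hay' : a ≠ y := hay.ne
      have hwy' : w ≠ y := e.ne
      have hT : ({y, a, w} : Finset V) ⊆ U := by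
        intro v hv
        simp at hv
        rcases hv with rfl | rfl | rfl <;> assumption
      have hTc : ({y, a, w} : Finset V).card = 3 := by
        rw [Finset.card_eq_three]
        exact ⟨y, a, w, hay'.symm, hwy'.symm, hwa.symm, rfl⟩
      obtain ⟨S, hSU, hcard, c, hc⟩ := ih (U \ {y, a, w})
        (Finset.sdiff_ssubset hT ⟨y, by simp⟩)
      rw [Finset.card_sdiff_of_subset hT, hTc] at hcard
      have h3 : 3 ≤ U.card := hTc ▸ Finset.card_le_card hT
      have hS : ∀ v ∈ S, v ∈ U ∧ v ≠ y ∧ v ≠ a ∧ v ≠ w := by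
        intro v hv
        have := hSU hv
        simp at this
        tauto
      have haS : a ∉ S := fun h => (hS a h).2.2.1 rfl
      have hwS : w ∉ insert a S := by
        intro h
        rcases Finset.mem_insert.mp h with h | h
        · exact hwa h
        · exact (hS w h).2.2.2 rfl
      obtain ⟨c1, hc1⟩ := extend hL hc haS (fun z hz z' hz' h h' =>
        hp.uniq hG hyU (hS z hz).1 (hS z' hz').1 hay h h' (hS z hz).2.1 (hS z' hz').2.1)
      have hS' : ∀ v ∈ insert a S, v ∈ U ∧ v ≠ y := by
        intro v hv
        rcases Finset.mem_insert.mp hv with rfl | hv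
        · exact ⟨haU, hay'⟩
        · exact ⟨(hS v hv).1, (hS v hv).2.1⟩
      obtain ⟨c2, hc2⟩ := extend hL hc1 hwS (fun z hz z' hz' h h' =>
        hrot.uniq hG hyU (hS' z hz).1 (hS' z' hz').1 e h h' (hS' z hz).2 (hS' z' hz').2)
      refine ⟨insert w (insert a S), ?_, ?_, c2, hc2⟩
      · intro v hv
        rcases Finset.mem_insert.mp hv with rfl | hv
        · exact hwU
        · exact (hS' v hv).1
      · rw [Finset.card_insert_of_notMem hwS, Finset.card_insert_of_notMem haS]
        omega
    · push Not at hy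
      obtain ⟨S, hSU, hcard, c, hc⟩ := ih (U.erase a) (Finset.erase_ssubset haU)
      rw [Finset.card_erase_of_mem haU] at hcard
      have haS : a ∉ S := fun h => Finset.notMem_erase a U (hSU h)
      have hS : ∀ v ∈ S, v ∈ U := fun v hv => Finset.mem_of_mem_erase (hSU hv)
      obtain ⟨c1, hc1⟩ := extend hL hc haS (fun z hz z' hz' h h' =>
        (hy z (hS z hz) h).trans (hy z' (hS z' hz') h').symm)
      refine ⟨insert a S, ?_, ?_, c1, hc1⟩
      · intro v hv
        rcases Finset.mem_insert.mp hv with rfl | hv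
        · exact haU
        · exact hS v hv
      · rw [Finset.card_insert_of_notMem haS]
        omega

end PLC

/-- For every 2-element list assignment, a chordless graph on `n` vertices has an
induced subgraph on at least `2n/3` vertices that is list colourable. -/
theorem partial_list_colouring_chordless {V : Type*} [Fintype V]
    (G : SimpleGraph V) (hG : Chordless G)
    (L : V → Finset ℕ) (hL : ∀ v, (L v).card = 2) :
    ∃ S : Finset V,
      (2 * Fintype.card V : ℚ) / 3 ≤ S.card ∧
      ∃ c : V → ℕ, (∀ v ∈ S, c v ∈ L v) ∧
        ∀ u ∈ S, ∀ v ∈ S, G.Adj u v → c u ≠ c v := by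
  obtain ⟨S, -, hcard, c, hc⟩ := PLC.main hG hL Finset.univ
  rw [Finset.card_univ] at hcard
  refine ⟨S, ?_, c, hc.1, hc.2⟩
  rw [div_le_iff₀ (by norm_num)]
  have h : ((2 * Fintype.card V : ℕ) : ℚ) ≤ ((3 * S.card : ℕ) : ℚ) := by exact_mod_cast hcard
  push_cast at h
  linarith
end

section
/- Let G be a 2-connected graph that is not a cycle, and suppose G is minimally 2-connected (i.e., no cycle of G has a chord). Let S be the set of vertices of G of degree 2. Then G \ S has at least two connected components, and every connected component of G \ S is a tree. -/
/-- `G` is 2-connected: it has at least 3 vertices and remains connected after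
deleting any single vertex. -/
def TwoConnected {V : Type*} [Fintype V] (G : SimpleGraph V) : Prop :=
  3 ≤ Fintype.card V ∧ ∀ v : V, (G.induce {u : V | u ≠ v}).Connected

namespace Plummer

open SimpleGraph

variable {V : Type*}

/-- Any two vertices are joined by a walk avoiding a third one. -/
def Conn2 (G : SimpleGraph V) : Prop :=
  ∀ u a b : V, a ≠ u → b ≠ u → ∃ p : G.Walk a b, u ∉ p.support

/-- `X` is the `x`-side of a separation of `G - xy` by the vertex `v`. -/
def Sep (G : SimpleGraph V) (x y v : V) (X : Set V) : Prop :=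
  x ∈ X ∧ y ∉ X ∧ v ∉ X ∧ y ≠ v ∧
    ∀ a ∈ X, ∀ b, b ∉ X → G.Adj a b → b = v ∨ (a = x ∧ b = y)

/-- There are two internally disjoint paths from `x` to `u`. -/
def Two (G : SimpleGraph V) (x u : V) : Prop :=
  ∃ P Q : G.Walk x u, P.IsPath ∧ Q.IsPath ∧
    ∀ z ∈ P.support, z ∈ Q.support → z = x ∨ z = u

lemma walk_of_induce {G : SimpleGraph V} {s : Set V} {a b : s} (p : (G.induce s).Walk a b) :
    ∃ q : G.Walk a.1 b.1, ∀ z ∈ q.support, z ∈ s := by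
  induction p with
  | @nil u => exact ⟨Walk.nil, by simp⟩
  | @cons a b c h p ih =>
    obtain ⟨q, hq⟩ := ih
    refine ⟨Walk.cons (show G.Adj a.1 b.1 from h) q, ?_⟩
    intro z hz
    rw [Walk.support_cons, List.mem_cons] at hz
    rcases hz with rfl | hz
    · exact a.2
    · exact hq z hz

lemma conn2_of [Fintype V] {G : SimpleGraph V} (h : TwoConnected G) : Conn2 G := by
  intro u a b ha hb
  obtain ⟨p⟩ := (h.2 u).preconnected ⟨a, ha⟩ ⟨b, hb⟩
  obtain ⟨q, hq⟩ := walk_of_induce p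
  exact ⟨q, fun hu => hq u hu rfl⟩

lemma exists_third [Fintype V] (h : 3 ≤ Fintype.card V) (x y : V) : ∃ z, x ≠ z ∧ y ≠ z := by
  classical
  obtain ⟨t, ht⟩ := Finset.exists_mem_notMem_of_card_lt_card
    (s := {x, y}) (t := Finset.univ) (by
      have := Finset.card_le_two (a := x) (b := y)
      rw [Finset.card_univ]; omega)
  refine ⟨t, ?_⟩
  simpa [eq_comm] using ht.2

lemma cutform {G : SimpleGraph V} (hc : Conn2 G) (A : Set V) {u a b : V}
    (ha : a ∈ A) (hb : b ∉ A) (hau : a ≠ u) (hbu : b ≠ u) :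
    ∃ c ∈ A, ∃ d, d ∉ A ∧ c ≠ u ∧ d ≠ u ∧ G.Adj c d := by
  obtain ⟨p, hp⟩ := hc u a b hau hbu
  obtain ⟨d, hd, h1, h2⟩ := p.exists_boundary_dart A ha hb
  refine ⟨d.fst, h1, d.snd, h2, ?_, ?_, d.adj⟩
  · rintro rfl; exact hp (p.dart_fst_mem_support_of_mem_darts hd)
  · rintro rfl; exact hp (p.dart_snd_mem_support_of_mem_darts hd)

lemma firstHit {G : SimpleGraph V} (T : Set V) {w x : V} (R : G.Walk w x) (hx : x ∈ T) :
    ∃ p ∈ T, ∃ R' : G.Walk w p, R'.IsPath ∧ (∀ z ∈ R'.support, z ∈ R.support) ∧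
      ∀ z ∈ R'.support, z ∈ T → z = p := by
  classical
  suffices h : ∃ p ∈ T, ∃ R' : G.Walk w p, (∀ z ∈ R'.support, z ∈ R.support) ∧
      ∀ z ∈ R'.support, z ∈ T → z = p by
    obtain ⟨p, hp, R', h1, h2⟩ := h
    exact ⟨p, hp, R'.bypass, R'.bypass_isPath,
      fun z hz => h1 z (R'.support_bypass_subset_support hz),
      fun z hz => h2 z (R'.support_bypass_subset_support hz)⟩
  induction R with
  | nil => exact ⟨_, hx, Walk.nil, by simp, by simp⟩
  | @cons a b c h R ih =>
    by_cases ha : a ∈ T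
    · exact ⟨a, ha, Walk.nil, by simp, by simp⟩
    · obtain ⟨p, hp, R', h1, h2⟩ := ih hx
      refine ⟨p, hp, Walk.cons h R', ?_, ?_⟩
      · intro z hz
        simp only [Walk.support_cons, List.mem_cons] at hz ⊢
        exact hz.imp id (h1 z)
      · intro z hz hT
        simp only [Walk.support_cons, List.mem_cons] at hz
        rcases hz with rfl | hz
        · exact absurd hT ha
        · exact h2 z hz hT

lemma isPath_append' {G : SimpleGraph V} {a b c : V} {p : G.Walk a b} {q : G.Walk b c}
    (hp : p.IsPath) (hq : q.IsPath) (h : ∀ z ∈ p.support, z ∈ q.support → z = b) :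
    (p.append q).IsPath := by
  induction p with
  | nil => simpa using hq
  | @cons a b' c' hab p ih =>
    rw [Walk.cons_isPath_iff] at hp
    rw [Walk.cons_append, Walk.cons_isPath_iff]
    refine ⟨ih hp.1 hq (fun z hz => h z (by simp [hz])), ?_⟩
    rw [Walk.mem_support_append_iff]
    rintro (h1 | h1)
    · exact hp.2 h1
    · have := h a (by simp) h1
      subst this
      exact hp.2 p.end_mem_support

lemma take_drop_disjoint [DecidableEq V] {G : SimpleGraph V} {x u w : V} {P : G.Walk x u}
    (hP : P.IsPath) (hw : w ∈ P.support) {z : V} (h1 : z ∈ (P.takeUntil w hw).support)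
    (h2 : z ∈ (P.dropUntil w hw).support) : z = w := by
  have hn := hP.support_nodup
  rw [← P.take_spec hw, Walk.support_append, List.nodup_append] at hn
  rw [Walk.mem_support_iff] at h2
  rcases h2 with h | h
  · exact h
  · exact absurd rfl (hn.2.2 z h1 z h)

lemma start_notMem_dropUntil [DecidableEq V] {G : SimpleGraph V} {x u w : V} {P : G.Walk x u}
    (hP : P.IsPath) (hw : w ∈ P.support) (hwx : w ≠ x) :
    x ∉ (P.dropUntil w hw).support := fun h =>
  hwx (take_drop_disjoint hP hw (Walk.start_mem_support _) h).symm

lemma two_step_mem {G : SimpleGraph V} {x u w : V} (P Q : G.Walk x u) (hP : P.IsPath)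
    (hQ : Q.IsPath) (hd : ∀ z ∈ P.support, z ∈ Q.support → z = x ∨ z = u) (hwx : w ≠ x)
    (hwu : w ≠ u) (hw : w ∈ P.support) : Two G x w := by
  classical
  refine ⟨P.takeUntil w hw, Q.append (P.dropUntil w hw).reverse, hP.takeUntil hw, ?_, ?_⟩
  · have hx := start_notMem_dropUntil hP hw hwx
    refine isPath_append' hQ (hP.dropUntil hw).reverse ?_
    intro z hz hz'
    rw [Walk.support_reverse, List.mem_reverse] at hz'
    rcases hd z (P.support_dropUntil_subset_support hw hz') hz with rfl | h
    · exact absurd hz' hx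
    · exact h
  · intro z hz hz'
    rw [Walk.mem_support_append_iff] at hz'
    rcases hz' with h | h
    · rcases hd z (P.support_takeUntil_subset_support hw hz) h with h | rfl
      · exact Or.inl h
      · exact absurd hz (Walk.endpoint_notMem_support_takeUntil hP hw hwu.symm)
    · rw [Walk.support_reverse, List.mem_reverse] at h
      exact Or.inr (take_drop_disjoint hP hw hz h)

lemma two_step_out {G : SimpleGraph V} {x u w p : V} (P Q : G.Walk x u) (hP : P.IsPath)
    (hQ : Q.IsPath) (hd : ∀ z ∈ P.support, z ∈ Q.support → z = x ∨ z = u)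
    (huw : G.Adj u w) (R : G.Walk w p) (hR : R.IsPath) (hp : p ∈ P.support) (hpu : p ≠ u)
    (hu : u ∉ R.support) (hwQ : w ∉ Q.support)
    (h1 : ∀ z ∈ R.support, z ∈ P.support → z = p)
    (h2 : ∀ z ∈ R.support, z ∈ Q.support → z = p) : Two G x w := by
  classical
  refine ⟨(P.takeUntil p hp).append R.reverse, Q.concat huw, ?_, hQ.concat hwQ huw, ?_⟩
  · refine isPath_append' (hP.takeUntil hp) hR.reverse ?_
    intro z hz hz'
    rw [Walk.support_reverse, List.mem_reverse] at hz'
    exact h1 z hz' (P.support_takeUntil_subset_support hp hz)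
  · intro z hz hz'
    rw [Walk.support_concat, List.mem_append, List.mem_singleton] at hz'
    rcases hz' with hz' | hz'
    · left
      have key : z ∈ P.support → z ≠ u → z = x := fun ha hb => (hd z ha hz').resolve_right hb
      rw [Walk.mem_support_append_iff] at hz
      rcases hz with h | h
      · refine key (P.support_takeUntil_subset_support hp h) ?_
        rintro rfl
        exact Walk.endpoint_notMem_support_takeUntil hP hp hpu.symm h
      · rw [Walk.support_reverse, List.mem_reverse] at h
        have := h2 z h hz'
        subst this
        exact key hp hpu
    · exact Or.inr hz'

lemma two_of_walk {G : SimpleGraph V} (hc : Conn2 G) {x u : V} (p : G.Walk u x) :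
    Two G x u := by
  induction p with
  | nil => exact ⟨Walk.nil, Walk.nil, by simp, by simp, by simp⟩
  | @cons w u x h p ih =>
    by_cases hwx : w = x
    · subst hwx
      exact ⟨Walk.nil, Walk.nil, by simp, by simp, by simp⟩
    by_cases hux : u = x
    · subst hux
      refine ⟨Walk.cons h.symm Walk.nil, Walk.cons h.symm Walk.nil, ?_, ?_, ?_⟩
      · simp [Walk.cons_isPath_iff, h.ne']
      · simp [Walk.cons_isPath_iff, h.ne']
      · simp
    obtain ⟨P, Q, hP, hQ, hd⟩ := ih
    by_cases hwP : w ∈ P.support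
    · exact two_step_mem P Q hP hQ hd hwx h.ne hwP
    by_cases hwQ : w ∈ Q.support
    · exact two_step_mem Q P hQ hP (fun z h1 h2 => hd z h2 h1) hwx h.ne hwQ
    obtain ⟨R, hR⟩ := hc u w x h.ne (Ne.symm hux)
    obtain ⟨p, hpT, R', hR', hs, hf⟩ := firstHit {z | z ∈ P.support ∨ z ∈ Q.support} R
      (Or.inl P.start_mem_support)
    have hu : u ∉ R'.support := fun hh => hR (hs u hh)
    have hpu : p ≠ u := by
      rintro rfl; exact hu R'.end_mem_support
    rcases hpT with hpT | hpT
    · exact two_step_out P Q hP hQ hd h.symm R' hR' hpT hpu hu hwQ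
        (fun z h1 h2 => hf z h1 (Or.inl h2)) (fun z h1 h2 => hf z h1 (Or.inr h2))
    · exact two_step_out Q P hQ hP (fun z h1 h2 => hd z h2 h1) h.symm R' hR' hpT hpu hu hwP
        (fun z h1 h2 => hf z h1 (Or.inr h2)) (fun z h1 h2 => hf z h1 (Or.inl h2))

/-- Two internally disjoint paths between vertices which are nonadjacent in `H` form a cycle. -/
lemma cycle_of_two {H : SimpleGraph V} {x y : V} (hxy : x ≠ y) (hn : ¬ H.Adj x y)
    (h : Two H x y) : ∃ c : H.Walk x x, c.IsCycle ∧ y ∈ c.support := by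
  obtain ⟨P, Q, hP, hQ, hd⟩ := h
  cases P with
  | nil => exact absurd rfl hxy
  | @cons _ a _ h P =>
    rw [Walk.cons_isPath_iff] at hP
    refine ⟨Walk.cons h (P.append Q.reverse), ?_, ?_⟩
    · rw [Walk.cons_isCycle_iff]
      constructor
      · refine isPath_append' hP.1 hQ.reverse ?_
        intro z hz hz'
        rw [Walk.support_reverse, List.mem_reverse] at hz'
        rcases hd z (by simp [hz]) hz' with rfl | h
        · exact absurd hz hP.2
        · exact h
      · rw [Walk.edges_append, List.mem_append]
        rintro (h1 | h1)
        · exact hP.2 (P.fst_mem_support_of_mem_edges h1)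
        · have h2 := Walk.snd_mem_support_of_mem_edges _ h1
          rw [Walk.support_reverse, List.mem_reverse] at h2
          rcases hd a (by simp) h2 with h3 | h3
          · exact h.ne h3.symm
          · subst h3; exact hn h
    · simp [Walk.mem_support_append_iff]

lemma exists_sep {G : SimpleGraph V} (hc : Conn2 G) (hch : Chordless G)
    (h3 : ∀ x y : V, ∃ z, x ≠ z ∧ y ≠ z) {x y : V}
    (hxy : G.Adj x y) : ∃ v X, Sep G x y v X := by
  classical
  set H := G.deleteEdges {s(x, y)} with hH
  have hle : H ≤ G := G.deleteEdges_le _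
  by_cases hv : ∃ v, x ≠ v ∧ y ≠ v ∧ ∀ p : H.Walk x y, v ∈ p.support
  · obtain ⟨v, h1, h2, h3⟩ := hv
    refine ⟨v, {u | ∃ p : H.Walk x u, v ∉ p.support}, ⟨Walk.nil, by simpa using h1.symm⟩,
      ?_, ?_, h2, ?_⟩
    · rintro ⟨p, hp⟩; exact hp (h3 p)
    · rintro ⟨p, hp⟩; exact hp p.end_mem_support
    · rintro a ⟨p, hp⟩ b hb hab
      by_contra hcon
      push Not at hcon
      by_cases he : s(a, b) = s(x, y)
      · rw [Sym2.eq_iff] at he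
        rcases he with ⟨rfl, rfl⟩ | ⟨rfl, rfl⟩
        · exact hcon.2 rfl rfl
        · exact hp (h3 p)
      · apply hb
        have hab' : H.Adj a b := by rw [hH, deleteEdges_adj]; exact ⟨hab, by simpa using he⟩
        refine ⟨p.concat hab', ?_⟩
        rw [Walk.support_concat, List.mem_append, List.mem_singleton]
        rintro (h | h)
        · exact hp h
        · exact hcon.1 h.symm
  · exfalso
    push Not at hv
    have hcH : Conn2 H := by
      intro u a b ha hb
      obtain ⟨p, hp⟩ := hc u a b ha hb
      clear ha hb
      induction p with
      | nil => exact ⟨Walk.nil, by simpa using hp⟩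
      | @cons a c b h p ih =>
        simp only [Walk.support_cons, List.mem_cons, not_or] at hp
        obtain ⟨q, hq⟩ := ih hp.2
        have hcu : c ≠ u := by rintro rfl; exact hp.2 p.start_mem_support
        have : ∃ r : H.Walk a c, u ∉ r.support := by
          by_cases he : s(a, c) = s(x, y)
          · rw [Sym2.eq_iff] at he
            rcases he with ⟨rfl, rfl⟩ | ⟨rfl, rfl⟩
            · exact hv u (Ne.symm hp.1) hcu
            · obtain ⟨r, hr⟩ := hv u hcu (Ne.symm hp.1)
              exact ⟨r.reverse, by simpa using hr⟩
          · have hab' : H.Adj a c := by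
              rw [hH, deleteEdges_adj]; exact ⟨h, by simpa using he⟩
            refine ⟨Walk.cons hab' Walk.nil, ?_⟩
            simp [hp.1, hcu.symm]
        obtain ⟨r, hr⟩ := this
        refine ⟨r.append q, ?_⟩
        rw [Walk.mem_support_append_iff]
        tauto
    have hn : ¬ H.Adj x y := by rw [hH, deleteEdges_adj]; simp
    have hreach : Nonempty (H.Walk y x) := by
      obtain ⟨z, h1, h2⟩ := h3 x y
      obtain ⟨p, -⟩ := hv z h1 h2
      exact ⟨p.reverse⟩
    obtain ⟨q⟩ := hreach
    obtain ⟨c, hcyc, hyc⟩ := cycle_of_two hxy.ne hn (two_of_walk hcH q)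
    have := hch x (c.mapLe hle) (hcyc.mapLe hle) x (by simp) y (by simpa using hyc) hxy
    rw [Walk.adj_toSubgraph_iff_mem_edges] at this
    rw [Walk.edges_mapLe_eq_edges] at this
    exact hn (Walk.adj_of_mem_edges _ this)

lemma third {G : SimpleGraph V} [Fintype V] [DecidableRel G.Adj] {x y w : V}
    (hy : G.Adj x y) (hw : G.Adj x w) (hne : w ≠ y) (hd : G.degree x ≠ 2) :
    ∃ z, G.Adj x z ∧ z ≠ y ∧ z ≠ w := by
  classical
  by_contra hcon
  push Not at hcon
  apply hd
  have : G.neighborFinset x = {y, w} := by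
    ext z
    simp only [mem_neighborFinset, Finset.mem_insert, Finset.mem_singleton]
    constructor
    · intro h
      by_cases hz : z = y
      · exact Or.inl hz
      · exact Or.inr (hcon z h hz)
    · rintro (rfl | rfl) <;> assumption
  rw [← card_neighborFinset_eq_degree, this, Finset.card_pair hne.symm]

lemma sep_symm {G : SimpleGraph V} {x y v : V} {X : Set V} (h : Sep G x y v X) :
    Sep G y x v {t | t ∉ X ∧ t ≠ v} := by
  obtain ⟨h1, h2, h3, h4, h5⟩ := h
  refine ⟨⟨h2, h4⟩, by simp [h1], by simp, by rintro rfl; exact h3 h1, ?_⟩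
  rintro a ⟨ha, hav⟩ b hb hab
  by_cases hbv : b = v
  · exact Or.inl hbv
  · have hbX : b ∈ X := by
      by_contra hh; exact hb ⟨hh, hbv⟩
    rcases h5 b hbX a ha hab.symm with h | h
    · exact absurd h hav
    · exact Or.inr ⟨h.2, h.1⟩

/-- The separating vertex has a neighbour on each side. -/
lemma sep_nbr {G : SimpleGraph V} (hc : Conn2 G) {x y v : V} {X : Set V}
    (h : Sep G x y v X) : ∃ c, c ∉ X ∧ c ≠ v ∧ G.Adj c v := by
  obtain ⟨h1, h2, h3, h4, h5⟩ := h
  obtain ⟨c, hcA, d, hdA, hcx, hdx, hcd⟩ := cutform hc {t | t ∉ X ∧ t ≠ v} (u := x) (a := y)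
    (b := v) ⟨h2, h4⟩ (by simp) (by rintro rfl; exact h2 h1) (by rintro rfl; exact h3 h1)
  have : d = v := by
    by_contra hdv
    have hdX : d ∈ X := by
      by_contra hh; exact hdA ⟨hh, hdv⟩
    rcases h5 d hdX c hcA.1 hcd.symm with h | h
    · exact hcA.2 h
    · exact hdx h.1
  subst this
  exact ⟨c, hcA.1, hcA.2, hcd⟩

lemma uncross {G : SimpleGraph V} [Fintype V] [DecidableRel G.Adj] (hc : Conn2 G)
    {x y v w v' : V} {X W : Set V} (hS : Sep G x y v X) (hT : Sep G w x v' W)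
    (hxy : G.Adj x y) (hxw : G.Adj x w) (hwy : w ≠ y) (hd : G.degree x ≠ 2) : v ∉ W := by
  intro hvW
  obtain ⟨c, hcX, hcv, hcadj⟩ := sep_nbr hc hS
  obtain ⟨z, hxz, hzy, hzw⟩ := third hxy hxw hwy hd
  obtain ⟨h1, h2, h3, h4, h5⟩ := hS
  obtain ⟨k1, k2, k3, k4, k5⟩ := hT
  have hxv : x ≠ v := by rintro rfl; exact h3 h1
  by_cases hv' : v' ∈ X
  · have hY : ∀ a, a ∉ X → a ≠ v → a ∉ W := by
      intro a ha hav haW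
      obtain ⟨c, ⟨c1, c2, c3⟩, d, hdA, -, hdv, hcd⟩ := cutform hc
        {t | t ∉ X ∧ t ≠ v ∧ t ∈ W} (u := v) (a := a) (b := x) ⟨ha, hav, haW⟩
        (fun h => h.1 h1) hav hxv
      by_cases hdX : d ∈ X
      · rcases h5 d hdX c c1 hcd.symm with h | ⟨rfl, rfl⟩
        · exact c2 h
        · rcases k5 c c3 d k2 hcd with h | h
          · exact k4 h
          · exact hwy h.1.symm
      · have hdW : d ∉ W := fun h => hdA ⟨hdX, hdv, h⟩
        rcases k5 c c3 d hdW hcd with rfl | ⟨_, rfl⟩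
        · exact hdX hv'
        · exact hdX h1
    rcases k5 v hvW c (hY c hcX hcv) hcadj.symm with rfl | ⟨_, rfl⟩
    · exact hcX hv'
    · exact hcX h1
  · have hB : ∀ a ∈ X, a ≠ x → a ∈ W := by
      intro a ha hax
      by_contra haW
      obtain ⟨c, ⟨c1, c2, c3⟩, d, hdA, -, hdx, hcd⟩ := cutform hc
        {t | t ∈ X ∧ t ≠ x ∧ t ∉ W} (u := x) (a := a) (b := v) ⟨ha, hax, haW⟩
        (fun h => h3 h.1) hax hxv.symm
      have hdW : d ∈ W := by
        by_cases hdX : d ∈ X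
        · by_contra hh; exact hdA ⟨hdX, hdx, hh⟩
        · rcases h5 c c1 d hdX hcd with rfl | h
          · exact hvW
          · exact absurd h.1 c2
      rcases k5 d hdW c c3 hcd.symm with rfl | h
      · exact hv' c1
      · exact c2 h.2
    have hzW : z ∈ W := by
      by_cases hzX : z ∈ X
      · exact hB z hzX hxz.ne'
      · rcases h5 x h1 z hzX hxz with rfl | h
        · exact hvW
        · exact absurd h.2 hzy
    rcases k5 z hzW x k2 hxz.symm with h | h
    · exact k4 h
    · exact hzw h.1

/-- Key lemma: no path of vertices of degree `≠ 2` runs from `x` to the separating vertex. -/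
lemma no_path {G : SimpleGraph V} [Fintype V] [DecidableRel G.Adj] (hc : Conn2 G)
    (hch : Chordless G) (h3 : ∀ x y : V, ∃ z, x ≠ z ∧ y ≠ z) (n : ℕ) :
    ∀ {x y v : V} {X : Set V} (P : G.Walk x v), P.length ≤ n →
    P.IsPath → y ∉ P.support → (∀ z ∈ P.support, G.degree z ≠ 2) → G.Adj x y →
    Sep G x y v X → False := by
  classical
  induction n with
  | zero =>
    intro x y v X P hn _ _ _ _ hS
    have := Walk.eq_of_length_eq_zero (Nat.le_zero.1 hn)
    subst this
    exact hS.2.2.1 hS.1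
  | succ n ih =>
    intro x y v X P hn hP hy hdeg hxy hS
    cases P with
    | nil => exact hS.2.2.1 hS.1
    | @cons _ w _ h Q =>
      rw [Walk.cons_isPath_iff] at hP
      simp only [Walk.support_cons, List.mem_cons, not_or] at hy
      have hwy : w ≠ y := by rintro rfl; exact hy.2 Q.start_mem_support
      obtain ⟨v', W, hT⟩ := exists_sep hc hch h3 h.symm
      have hvW := uncross hc hS hT hxy h hwy (hdeg x (by simp))
      obtain ⟨d, hd, d1, d2⟩ := Q.exists_boundary_dart W hT.1 hvW
      have hdQ := Q.dart_snd_mem_support_of_mem_darts hd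
      have hv'Q : v' ∈ Q.support := by
        rcases hT.2.2.2.2 _ d1 _ d2 d.adj with h | h
        · rwa [← h]
        · rw [h.2] at hdQ; exact absurd hdQ hP.2
      refine ih (Q.takeUntil v' hv'Q) ?_ (hP.1.takeUntil hv'Q)
        (fun hh => hP.2 (Q.support_takeUntil_subset_support hv'Q hh))
        (fun z hz => hdeg z ?_) h.symm hT
      · have := Q.length_takeUntil_le_length hv'Q
        rw [Walk.length_cons] at hn
        omega
      · rw [Walk.support_cons]
        exact List.mem_cons_of_mem _ (Q.support_takeUntil_subset_support hv'Q hz)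

/-- The separating vertex can be chosen of degree `≠ 2`. -/
lemma sep_deg {G : SimpleGraph V} [Fintype V] [DecidableRel G.Adj] (hc : Conn2 G)
    {x y : V} (hxy : G.Adj x y) (hd : G.degree x ≠ 2) (n : ℕ) :
    ∀ {v : V} {X : Set V}, X.ncard ≤ n → Sep G x y v X →
    ∃ v X, Sep G x y v X ∧ G.degree v ≠ 2 := by
  classical
  induction n with
  | zero =>
    intro v X hn hS
    have := (Set.ncard_eq_zero (Set.toFinite X)).1 (Nat.le_zero.1 hn)
    have := hS.1
    simp_all
  | succ n ih =>
    intro v X hn hS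
    by_cases hv : G.degree v = 2
    swap
    · exact ⟨v, X, hS, hv⟩
    obtain ⟨c, hcX, hcv, hcadj⟩ := sep_nbr hc hS
    obtain ⟨c', hc'X, hc'v, hc'adj⟩ := sep_nbr hc (sep_symm hS)
    have hc'X : c' ∈ X := by
      by_contra hh; exact hc'X ⟨hh, hc'v⟩
    have hnb : ∀ z, G.Adj v z → z = c ∨ z = c' := by
      intro z hz
      have hne : c ≠ c' := by rintro rfl; exact hcX hc'X
      have hsub : ({c, c'} : Finset V) ⊆ G.neighborFinset v := by
        intro t
        simp only [Finset.mem_insert, Finset.mem_singleton, mem_neighborFinset]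
        rintro (rfl | rfl)
        · exact hcadj.symm
        · exact hc'adj.symm
      have heq := Finset.eq_of_subset_of_card_le hsub
        (by rw [card_neighborFinset_eq_degree, hv, Finset.card_pair hne])
      have : z ∈ G.neighborFinset v := by simpa using hz
      rw [← heq] at this
      simpa using this
    obtain ⟨h1, h2, h3, h4, h5⟩ := hS
    by_cases hcx : c' = x
    · subst hcx
      exfalso
      have hX : ∀ a ∈ X, a = c' := by
        intro a ha
        by_contra hax
        obtain ⟨e, ⟨e1, e2⟩, d, hdA, -, hdx, hed⟩ := cutform hc
          {t | t ∈ X ∧ t ≠ c'} (u := c') (a := a) (b := v) ⟨ha, hax⟩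
          (fun h => h3 h.1) hax hc'v.symm
        have hdX : d ∉ X := fun h => hdA ⟨h, hdx⟩
        rcases h5 e e1 d hdX hed with rfl | h
        · rcases hnb e hed.symm with rfl | h
          · exact hcX e1
          · exact e2 h
        · exact e2 h.1
      obtain ⟨z, hz, hzy, hzv⟩ := third hxy hc'adj h4.symm hd
      by_cases hzX : z ∈ X
      · exact hz.ne' (hX z hzX)
      · rcases h5 c' h1 z hzX hz with h | h
        · exact hzv h
        · exact hzy h.2
    · refine ih (v := c') (X := X \ {c'}) ?_ ⟨⟨h1, fun h => hcx h.symm⟩, fun h => h2 h.1,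
        by simp, by rintro rfl; exact h2 hc'X, ?_⟩
      · have := Set.ncard_sdiff_singleton_lt_of_mem hc'X (Set.toFinite X)
        omega
      · rintro a ⟨ha, hac⟩ b hb hab
        by_cases hbc : b = c'
        · exact Or.inl hbc
        · have hbX : b ∉ X := fun h => hb ⟨h, hbc⟩
          rcases h5 a ha b hbX hab with rfl | h
          · rcases hnb a hab.symm with rfl | h
            · exact absurd ha hcX
            · exact absurd h hac
          · exact Or.inr h

lemma exists_cycle {G : SimpleGraph V} [Fintype V] (hc : Conn2 G) (h3 : 3 ≤ Fintype.card V) :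
    ∃ (u : V) (c : G.Walk u u), c.IsCycle := by
  classical
  obtain ⟨a, b, c, hab, hac, hbc⟩ := Fintype.two_lt_card_iff.1 h3
  obtain ⟨x, hx, y, hy, -, -, hxy⟩ := cutform hc {a} (u := c) (a := a) (b := b) rfl
    (fun h => hab h.symm) hac hbc
  rw [Set.mem_singleton_iff] at hx
  subst hx
  have : ∃ t, t ≠ x ∧ t ≠ y := by
    by_cases h : b = y
    · exact ⟨c, hac.symm, fun h' => hbc (h.trans h'.symm)⟩
    · exact ⟨b, hab.symm, h⟩
  obtain ⟨t, htx, hty⟩ := this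
  obtain ⟨x', hx', z, hz, -, hzy, hxz⟩ := cutform hc {x} (u := y) (a := x) (b := t) rfl
    htx hxy.ne hty
  rw [Set.mem_singleton_iff] at hx'
  subst hx'
  obtain ⟨p, hp⟩ := hc x' z y hxz.ne' hxy.ne'
  have hp' : x' ∉ p.bypass.support := fun h => hp (p.support_bypass_subset_support h)
  refine ⟨y, Walk.cons hxy.symm (Walk.cons hxz p.bypass), ?_⟩
  rw [Walk.cons_isCycle_iff, Walk.cons_isPath_iff]
  refine ⟨⟨p.bypass_isPath, hp'⟩, ?_⟩
  rw [Walk.edges_cons, List.mem_cons]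
  rintro (h | h)
  · rw [Sym2.eq_iff] at h
    rcases h with h | h
    · exact hxy.ne h.1.symm
    · exact hzy h.1.symm
  · exact hp' (Walk.snd_mem_support_of_mem_edges _ h)

lemma iso_of_spanning {G : SimpleGraph V} [Fintype V] [DecidableRel G.Adj] (hch : Chordless G)
    {u : V} (c : G.Walk u u) (hcyc : c.IsCycle) (hsp : ∀ v, v ∈ c.support) :
    ∃ n : ℕ, Nonempty (G ≃g SimpleGraph.cycleGraph n) := by
  classical
  have hham : c.IsHamiltonianCycle := by
    rw [Walk.isHamiltonianCycle_isCycle_and_isHamiltonian_tail]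
    refine ⟨hcyc, hcyc.isPath_tail.isHamiltonian_of_mem ?_⟩
    intro w
    rw [Walk.support_tail_of_not_nil _ hcyc.not_nil]
    have := hsp w
    rw [Walk.mem_support_iff] at this
    rcases this with rfl | h
    · exact c.end_mem_tail_support hcyc.not_nil
    · exact h
  have hlen := hham.length_eq
  have h3 := hcyc.three_le_length
  obtain ⟨f⟩ := (cycleGraph_isContained_iff (G := G) (n := c.length) (by omega)).2
    ⟨u, c, hcyc, rfl⟩
  have hbij : Function.Bijective f.toHom := by
    rw [Fintype.bijective_iff_injective_and_card]
    exact ⟨f.injective, by simp [hlen]⟩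
  have hdeg : ∀ v, G.degree v = 2 := by
    intro v
    rw [← hcyc.ncard_neighborSet_toSubgraph_eq_two (hsp v), ← card_neighborFinset_eq_degree,
      ← Set.ncard_coe_finset]
    congr 1
    ext w
    simp only [coe_neighborFinset, mem_neighborSet, Subgraph.mem_neighborSet]
    exact ⟨fun h => hch u c hcyc v (hsp v) w (hsp w) h, fun h => h.adj_sub⟩
  have hadj : ∀ i j, G.Adj (f.toHom i) (f.toHom j) ↔ (cycleGraph c.length).Adj i j := by
    intro i j
    refine ⟨fun h => ?_, fun h => f.toHom.map_adj h⟩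
    have hsub : ((cycleGraph c.length).neighborFinset i).image f.toHom ⊆
        G.neighborFinset (f.toHom i) := by
      intro t ht
      obtain ⟨k, hk, rfl⟩ := Finset.mem_image.1 ht
      rw [mem_neighborFinset] at hk ⊢
      exact f.toHom.map_adj hk
    have hci : (cycleGraph c.length).degree i = 2 := by
      obtain ⟨m, hm⟩ : ∃ m, c.length = m + 3 := ⟨c.length - 3, by omega⟩
      clear * - hm
      revert i
      rw [hm]
      intro i
      convert cycleGraph_degree_three_le
    have heq := Finset.eq_of_subset_of_card_le hsub (by
      rw [Finset.card_image_of_injective _ f.injective, card_neighborFinset_eq_degree,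
        card_neighborFinset_eq_degree, hdeg, hci])
    have hm : f.toHom j ∈ G.neighborFinset (f.toHom i) := by simpa using h
    rw [← heq] at hm
    obtain ⟨k, hk, hkj⟩ := Finset.mem_image.1 hm
    rw [mem_neighborFinset] at hk
    rwa [← hbij.1 hkj]
  exact ⟨c.length, ⟨(⟨Equiv.ofBijective _ hbij, hadj _ _⟩ :
    cycleGraph c.length ≃g G).symm⟩⟩

lemma iso_of_deg {G : SimpleGraph V} [Fintype V] [DecidableRel G.Adj] (hc : Conn2 G)
    (h3 : 3 ≤ Fintype.card V) (hch : Chordless G) (r : V)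
    (hr : ∀ v, v ≠ r → G.degree v = 2) :
    ∃ n : ℕ, Nonempty (G ≃g SimpleGraph.cycleGraph n) := by
  classical
  obtain ⟨u, c, hcyc⟩ := exists_cycle hc h3
  have hclosed : ∀ a ∈ c.support, a ≠ r → ∀ b, G.Adj a b → b ∈ c.support := by
    intro a ha har b hab
    have h2 := hcyc.ncard_neighborSet_toSubgraph_eq_two ha
    have heq : c.toSubgraph.neighborSet a = G.neighborSet a := by
      apply Set.eq_of_subset_of_ncard_le (c.toSubgraph.neighborSet_subset a) _ (Set.toFinite _)
      rw [h2, ← coe_neighborFinset, Set.ncard_coe_finset, card_neighborFinset_eq_degree, hr a har]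
    have hb : b ∈ G.neighborSet a := hab
    rw [← heq] at hb
    exact Walk.mem_support_of_adj_toSubgraph hb.symm
  obtain ⟨a, ha, har⟩ : ∃ a ∈ c.support, a ≠ r := by
    by_cases h : u = r
    · refine ⟨c.snd, c.getVert_mem_support 1, ?_⟩
      rw [← h]
      exact (c.adj_snd hcyc.not_nil).ne'
    · exact ⟨u, c.start_mem_support, h⟩
  have hall : ∀ b, b ≠ r → b ∈ c.support := by
    intro b hb
    by_contra hbc
    obtain ⟨e, he, d, hd, her, -, hed⟩ := cutform hc {t | t ∈ c.support} ha hbc har hb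
    exact hd (hclosed e he her d hed)
  have hrc : r ∈ c.support := by
    obtain ⟨t, htr, hta⟩ : ∃ t, t ≠ r ∧ t ≠ a := by
      obtain ⟨t, h1, h2⟩ := exists_third h3 r a
      exact ⟨t, h1.symm, h2.symm⟩
    obtain ⟨e, he, d, hd, -, -, hed⟩ := cutform hc {r} (u := t) (a := r) (b := a) rfl har
      htr.symm hta.symm
    rw [Set.mem_singleton_iff] at he
    subst he
    exact hclosed d (hall d hd) hd e hed.symm
  refine iso_of_spanning hch c hcyc ?_
  intro v
  by_cases h : v = r
  · rwa [h]
  · exact hall v h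

end Plummer

/-- Plummer's lemma: if `G` is minimally 2-connected (2-connected and chordless)
and not a cycle, and `S` is its set of degree-2 vertices, then `G \ S` has at
least two connected components and every component of `G \ S` is a tree (i.e.
`G \ S` is an acyclic graph with at least two components). -/
theorem plummer_minimally_two_connected
    {V : Type*} [Fintype V] (G : SimpleGraph V) [DecidableRel G.Adj]
    (h2 : TwoConnected G) (hch : Chordless G)
    (hnotcycle : ¬ ∃ n : ℕ, Nonempty (G ≃g SimpleGraph.cycleGraph n)) :
    (∃ c d : (G.induce {v : V | G.degree v ≠ 2}).ConnectedComponent, c ≠ d) ∧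
      (G.induce {v : V | G.degree v ≠ 2}).IsAcyclic := by
  classical
  have hc := Plummer.conn2_of h2
  have h3 : ∀ x y : V, ∃ z, x ≠ z ∧ y ≠ z := Plummer.exists_third h2.1
  constructor
  · by_contra hcon
    push Not at hcon
    have hpre : ∀ a b, (G.induce {v : V | G.degree v ≠ 2}).Reachable a b := fun a b =>
      SimpleGraph.ConnectedComponent.exact (hcon _ _)
    -- there are two distinct vertices of degree different from 2
    obtain ⟨x, t, hx, ht, hxt⟩ : ∃ x t, G.degree x ≠ 2 ∧ G.degree t ≠ 2 ∧ x ≠ t := by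
      by_contra hno
      push Not at hno
      apply hnotcycle
      by_cases hr : ∃ r, G.degree r ≠ 2
      · obtain ⟨r, hr⟩ := hr
        refine Plummer.iso_of_deg hc h2.1 hch r (fun v hv => ?_)
        by_contra hv2
        exact hv (hno v r hv2 hr)
      · push Not at hr
        have : 0 < Fintype.card V := by have := h2.1; omega
        obtain ⟨r⟩ := Fintype.card_pos_iff.1 this
        exact Plummer.iso_of_deg hc h2.1 hch r (fun v _ => hr v)
    -- an edge between such vertices
    obtain ⟨y, hy, hxy⟩ : ∃ y, G.degree y ≠ 2 ∧ G.Adj x y := by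
      obtain ⟨p⟩ := hpre ⟨x, hx⟩ ⟨t, ht⟩
      cases p with
      | nil => exact absurd rfl hxt
      | @cons _ b _ h p => exact ⟨b.1, b.2, h⟩
    obtain ⟨v₀, X₀, hS₀⟩ := Plummer.exists_sep hc hch h3 hxy
    obtain ⟨v, X, hS, hv⟩ := Plummer.sep_deg hc hxy hx _ le_rfl hS₀
    obtain ⟨p⟩ := hpre ⟨x, hx⟩ ⟨v, hv⟩
    obtain ⟨P, hP⟩ : ∃ P : G.Walk x v, ∀ z ∈ P.support, G.degree z ≠ 2 :=
      Plummer.walk_of_induce p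
    have hPdeg : ∀ z ∈ P.bypass.support, G.degree z ≠ 2 :=
      fun z hz => hP z (P.support_bypass_subset_support hz)
    have hPp := P.bypass_isPath
    generalize P.bypass = Q at hPdeg hPp
    by_cases hyQ : y ∈ Q.support
    · refine Plummer.no_path hc hch h3 _ (Q.dropUntil y hyQ) le_rfl (hPp.dropUntil hyQ) (y := x) ?_
        (fun z hz => hPdeg z (Q.support_dropUntil_subset_support hyQ hz)) hxy.symm
        (Plummer.sep_symm hS)
      exact Plummer.start_notMem_dropUntil hPp hyQ hxy.ne'
    · exact Plummer.no_path hc hch h3 _ Q le_rfl hPp hyQ hPdeg hxy hS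
  · intro u c₀ hcyc₀
    have hcyc : (c₀.map (SimpleGraph.Embedding.induce _).toHom).IsCycle :=
      hcyc₀.map (SimpleGraph.Embedding.induce (G := G) {v : V | G.degree v ≠ 2}).injective
    have hdeg : ∀ z ∈ (c₀.map (SimpleGraph.Embedding.induce
        {v : V | G.degree v ≠ 2}).toHom).support, G.degree z ≠ 2 := by
      intro z hz
      rw [SimpleGraph.Walk.support_map] at hz
      obtain ⟨z', _, rfl⟩ := List.mem_map.1 hz
      exact z'.2
    generalize c₀.map (SimpleGraph.Embedding.induce _).toHom = c at hcyc hdeg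
    cases c with
    | nil => simp at hcyc
    | @cons _ x _ h p =>
      rw [SimpleGraph.Walk.cons_isCycle_iff] at hcyc
      obtain ⟨v, X, hS⟩ := Plummer.exists_sep hc hch h3 h.symm
      obtain ⟨d, hd, d1, d2⟩ := p.exists_boundary_dart X hS.1 hS.2.1
      have hvp : v ∈ p.support := by
        have hdp := p.dart_snd_mem_support_of_mem_darts hd
        rcases hS.2.2.2.2 _ d1 _ d2 d.adj with h' | ⟨h1, h3⟩
        · rwa [← h']
        · exfalso
          apply hcyc.2
          have := List.mem_map_of_mem (f := SimpleGraph.Dart.edge) hd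
          have he : d.edge = s(d.snd, d.fst) := by
            rw [Sym2.eq_swap]; rfl
          rw [he, h1, h3] at this
          exact this
      refine Plummer.no_path hc hch h3 _ (p.takeUntil v hvp) le_rfl (hcyc.1.takeUntil hvp)
        (SimpleGraph.Walk.endpoint_notMem_support_takeUntil hcyc.1 hvp hS.2.2.2.1)
        (fun z hz => hdeg z ?_) h.symm hS
      rw [SimpleGraph.Walk.support_cons]
      exact List.mem_cons_of_mem _ (p.support_takeUntil_subset_support hvp hz)
end
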